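/- Optimality of the multi-channel Huffman merge recurrence: for source masses p_1 ≤ p_2 ≤ … ≤ p_m with m ≥ 2 summing to 1, let L_opt(p_1,…,p_m) denote the minimum expected codeword length over all decoding trees for these masses. Then L_opt(p_1,…,p_m) = min over k ∈ {2,…,min(q_n,m)} of [ L_opt((p_1+⋯+p_k), p_{k+1}, …, p_m) + (Σ_{j=1}^k p_j) · ln q_{i*(k)} ], where q_{i*(k)} is the smallest among {q_1,…,q_n} with q_{i*(k)} ≥ k. Consequently, there exists a merge sequence—a sequence of choices of how many smallest masses to merge in each iteration of the generalized Huffman procedure—that produces an optimal multi-channel tree-decodable code. -/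

import Mathlib

/-- A multi-channel decoding tree for an `n`-channel system with alphabet sizes `q i`:
leaves carry probability masses and every internal node is assigned a channel class
`i ∈ {1,…,n}`. -/
inductive PTree (n : ℕ) (q : Fin n → ℕ) : Type
  | leaf (mass : ℝ) : PTree n q
  | node (i : Fin n) (children : List (PTree n q)) : PTree n q

namespace PTree

variable {n : ℕ} {q : Fin n → ℕ}

/-- The list of leaf masses of a decoding tree (in left-to-right order). -/
def leafMasses : PTree n q → List ℝ
  | .leaf x => [x]
  | .node _ cs => (cs.attach.map fun c => leafMasses c.1).flatten
decreasing_by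
  simp_wf
  have := List.sizeOf_lt_of_mem c.2
  omega

/-- The total leaf mass of a tree; for a subtree rooted at an internal node this is the
reaching probability `s` of that node. -/
noncomputable def mass (t : PTree n q) : ℝ := t.leafMasses.sum

/-- Well-formedness of a decoding tree: every internal node of class `i` has at least one
and at most `q i` children (its outgoing edges being labeled by distinct symbols of the
`i`-th alphabet), and all its subtrees are well-formed. -/
inductive WF : PTree n q → Prop
  | leaf (x : ℝ) : WF (.leaf x)
  | node (i : Fin n) (cs : List (PTree n q)) :
      cs ≠ [] → cs.length ≤ q i → (∀ c ∈ cs, WF c) → WF (.node i cs)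

/-- The list of pairs (leaf mass, description length of the leaf), where the description
length of a leaf is the sum of `ln (q i)` over its internal-node ancestors of class `i`. -/
noncomputable def leafData : PTree n q → List (ℝ × ℝ)
  | .leaf x => [(x, 0)]
  | .node i cs =>
      ((cs.attach.map fun c => leafData c.1).flatten).map fun pr =>
        (pr.1, pr.2 + Real.log (q i))
decreasing_by
  simp_wf
  have := List.sizeOf_lt_of_mem c.2
  omega

/-- The expected codeword (description) length of the tree in nats: the expectation of the
leaf description lengths under the leaf masses. -/
noncomputable def expLen (t : PTree n q) : ℝ := (t.leafData.map fun pr => pr.1 * pr.2).sum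

end PTree

/-- The minimum expected codeword length over all decoding trees whose leaves are assigned
the masses in the multiset `P` together with any number of dummy leaves of mass `0`. -/
noncomputable def Lopt (n : ℕ) (q : Fin n → ℕ) (P : Multiset ℝ) : ℝ :=
  sInf {x : ℝ | ∃ t : PTree n q, t.WF ∧
    (∃ w : ℕ, (t.leafMasses : Multiset ℝ) = P + Multiset.replicate w 0) ∧ x = t.expLen}

theorem exists_add_of_map_eq_add {α β : Type*} {f : α → β} {A B : Multiset β} :
    ∀ {D : Multiset α}, D.map f = A + B → ∃ A' B', D = A' + B' ∧ A'.map f = A ∧ B'.map f = B := by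
  induction A using Multiset.induction_on with
  | empty =>
    intro D h
    exact ⟨0, D, by simp, by simp, by simpa using h⟩
  | cons a A ih =>
    intro D h
    rw [Multiset.cons_add] at h
    obtain ⟨d, hd, rfl⟩ := Multiset.mem_map.1 (h ▸ Multiset.mem_cons_self a (A + B))
    obtain ⟨D, rfl⟩ := Multiset.exists_cons_of_mem hd
    rw [Multiset.map_cons, Multiset.cons_inj_right] at h
    obtain ⟨A', B', rfl, rfl, rfl⟩ := ih h
    exact ⟨d ::ₘ A', B', by simp, by simp, rfl⟩

/-- `LengthProfile q r L`: the multiset `L` arises from `{0}` by repeatedly replacing an entry `l`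
with `k` copies of `l + log (q i)`, where `r ≤ k ≤ q i`. These are the multisets of description
lengths of decoding trees all of whose internal nodes have at least `r` children. -/
inductive LengthProfile {n : ℕ} (q : Fin n → ℕ) (r : ℕ) : Multiset ℝ → Prop
  | zero : LengthProfile q r {0}
  | split (l : ℝ) (L : Multiset ℝ) (i : Fin n) (k : ℕ) : LengthProfile q r (l ::ₘ L) →
      r ≤ k → k ≤ q i → LengthProfile q r (Multiset.replicate k (l + Real.log (q i)) + L)

namespace LengthProfile

variable {n : ℕ} {q : Fin n → ℕ} {r : ℕ}

theorem anti {r' : ℕ} (hr : r' ≤ r) {L : Multiset ℝ} (h : LengthProfile q r L) :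
    LengthProfile q r' L := by
  induction h with
  | zero => exact zero
  | split l L i k _ h1 h2 ih => exact split l L i k ih (hr.trans h1) h2

theorem nonneg {L : Multiset ℝ} (h : LengthProfile q r L) : ∀ x ∈ L, 0 ≤ x := by
  induction h with
  | zero => simp
  | split l L i k _ h1 h2 ih =>
    intro x hx
    rcases Multiset.mem_add.1 hx with hx | hx
    · rw [Multiset.eq_of_mem_replicate hx]
      have := ih l (Multiset.mem_cons_self _ _)
      have := Real.log_natCast_nonneg (q i)
      positivity
    · exact ih x (Multiset.mem_cons_of_mem hx)

/-- Grafting: an entry of a length profile may be replaced by a shifted length profile. -/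
theorem graft {M : Multiset ℝ} (hM : LengthProfile q r M) (l : ℝ) (L : Multiset ℝ)
    (hL : LengthProfile q r (l ::ₘ L)) : LengthProfile q r (M.map (l + ·) + L) := by
  induction hM with
  | zero => simpa using hL
  | split l' L' i k _ h1 h2 ih =>
    rw [Multiset.map_cons, Multiset.cons_add] at ih
    have := split _ _ i k ih h1 h2
    simpa [Multiset.map_replicate, add_assoc] using this

/-- Pruning: any nonempty sub-multiset of a length profile dominates a length profile without
unary splits. -/
theorem exists_rel_le {L : Multiset ℝ} (h : LengthProfile q 1 L) :
    ∀ M ≤ L, M ≠ 0 → ∃ L', LengthProfile q 2 L' ∧ Multiset.Rel (· ≤ ·) L' M := by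
  induction h with
  | zero =>
    intro M hM h0
    rcases Multiset.le_singleton.1 hM with rfl | rfl
    · exact absurd rfl h0
    · exact ⟨_, zero, Multiset.Rel.cons le_rfl Multiset.Rel.zero⟩
  | split l L i k _ h1 h2 ih =>
    intro M hM h0
    obtain ⟨A, B, hA, hB, rfl⟩ : ∃ A B, A ≤ Multiset.replicate k (l + Real.log (q i)) ∧ B ≤ L ∧
        M = A + B := by
      refine ⟨M ∩ Multiset.replicate k (l + Real.log (q i)),
        M - Multiset.replicate k (l + Real.log (q i)), Multiset.inter_le_right, ?_, ?_⟩
      · rw [Multiset.sub_le_iff_le_add, add_comm]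
        exact hM
      · rw [add_comm, Multiset.sub_add_inter]
    obtain ⟨j, hj, rfl⟩ := Multiset.le_replicate_iff.1 hA
    rcases Nat.eq_zero_or_pos j with rfl | hj0
    · simp only [Multiset.replicate_zero, zero_add] at h0 ⊢
      exact ih B (hB.trans (Multiset.le_cons_self _ _)) h0
    · obtain ⟨L', hL', hrel⟩ := ih (l ::ₘ B) ((Multiset.cons_le_cons_iff _).2 hB)
        (Multiset.cons_ne_zero)
      obtain ⟨l', L'', hl, hrel', rfl⟩ := Multiset.rel_cons_right.1 hrel
      have hq := Real.log_natCast_nonneg (q i)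
      rcases (show j = 1 ∨ 2 ≤ j by omega) with rfl | hj2
      · refine ⟨_, hL', ?_⟩
        simpa using Multiset.Rel.cons (show l' ≤ l + Real.log (q i) by linarith) hrel'
      · refine ⟨_, split l' L'' i j hL' hj2 (hj.trans h2), Multiset.Rel.add ?_ hrel'⟩
        rw [Multiset.rel_replicate_left]
        refine ⟨by simp, fun x hx => ?_⟩
        rw [Multiset.eq_of_mem_replicate hx]
        linarith

/-- A nontrivial length profile has a last split producing entries of maximal length. -/
theorem exists_max_split (hq : ∀ i, 2 ≤ q i) {L : Multiset ℝ} (h : LengthProfile q 2 L) :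
    L = {0} ∨ ∃ l L' i k, LengthProfile q 2 (l ::ₘ L') ∧ 2 ≤ k ∧ k ≤ q i ∧
      L = Multiset.replicate k (l + Real.log (q i)) + L' ∧
      ∀ x ∈ L', x ≤ l + Real.log (q i) := by
  induction h with
  | zero => exact Or.inl rfl
  | split l L i k hL h1 h2 ih =>
    right
    have hpos : 0 < Real.log (q i) :=
      Real.log_pos (by exact_mod_cast (show 1 < q i from hq i))
    rcases ih with h0 | ⟨l', L', i', k', hL', h1', h2', heq, hmax⟩
    · refine ⟨l, L, i, k, hL, h1, h2, rfl, fun x hx => ?_⟩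
      have hc := congrArg Multiset.card h0
      rw [Multiset.card_cons, Multiset.card_singleton, Nat.add_eq_right,
        Multiset.card_eq_zero] at hc
      simp [hc] at hx
    · by_cases hle : l' + Real.log (q i') ≤ l + Real.log (q i)
      · refine ⟨l, L, i, k, hL, h1, h2, rfl, fun x hx => ?_⟩
        have hx : x ∈ l ::ₘ L := Multiset.mem_cons_of_mem hx
        rw [heq] at hx
        rcases Multiset.mem_add.1 hx with hx | hx
        · rw [Multiset.eq_of_mem_replicate hx]
          exact hle
        · exact (hmax x hx).trans hle
      · push Not at hle
        have hl : l ∈ l ::ₘ L := Multiset.mem_cons_self _ _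
        rw [heq] at hl
        have hl : l ∈ L' := by
          rcases Multiset.mem_add.1 hl with hl | hl
          · have := Multiset.eq_of_mem_replicate hl
            linarith
          · exact hl
        obtain ⟨L'', rfl⟩ := Multiset.exists_cons_of_mem hl
        rw [Multiset.add_cons, Multiset.cons_inj_right] at heq
        subst heq
        refine ⟨l', Multiset.replicate k (l + Real.log (q i)) + L'', i', k', ?_, h1', h2', ?_, ?_⟩
        · rw [Multiset.cons_swap] at hL'
          simpa using split _ _ i k hL' h1 h2
        · rw [add_left_comm]
        · intro x hx
          rcases Multiset.mem_add.1 hx with hx | hx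
          · rw [Multiset.eq_of_mem_replicate hx]
            exact hle.le
          · exact hmax x (Multiset.mem_cons_of_mem hx)

end LengthProfile

namespace PTree

variable {n : ℕ} {q : Fin n → ℕ}

theorem leafMasses_node (i : Fin n) (cs : List (PTree n q)) :
    (node i cs).leafMasses = (cs.map leafMasses).flatten := by
  rw [leafMasses]
  simp

theorem leafData_node (i : Fin n) (cs : List (PTree n q)) :
    (node i cs).leafData =
      (cs.map leafData).flatten.map fun pr => (pr.1, pr.2 + Real.log (q i)) := by
  rw [leafData]
  simp

theorem leafData_leaf (x : ℝ) : (leaf x : PTree n q).leafData = [(x, 0)] := by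
  rw [leafData]

theorem WF.leafMasses_eq {t : PTree n q} (h : t.WF) : t.leafMasses = t.leafData.map Prod.fst := by
  induction h with
  | leaf x => simp [leafMasses, leafData_leaf]
  | node i cs _ _ _ ih =>
    rw [leafMasses_node, leafData_node, List.map_map, List.map_congr_left ih]
    simp [List.map_flatten, Function.comp_def]

theorem lengthProfile_children (i : Fin n) (cs : List (PTree n q))
    (h : ∀ c ∈ cs, LengthProfile q 1 (c.leafData.map Prod.snd : List ℝ)) :
    ∀ L : Multiset ℝ, LengthProfile q 1 (Multiset.replicate cs.length (Real.log (q i)) + L) →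
      LengthProfile q 1 (((node i cs).leafData.map Prod.snd : List ℝ) + L) := by
  induction cs with
  | nil =>
    intro L hL
    simpa [leafData_node] using hL
  | cons c cs ih =>
    intro L hL
    rw [List.length_cons, Multiset.replicate_succ, Multiset.cons_add] at hL
    have hg := (h c (by simp)).graft _ _ hL
    rw [add_left_comm] at hg
    have := ih (fun c hc => h c (by simp [hc])) _ hg
    rw [leafData_node] at this ⊢
    rw [add_left_comm, ← add_assoc] at this
    convert this using 2
    simp [Function.comp_def, add_comm]

theorem WF.lengthProfile {t : PTree n q} (h : t.WF) :
    LengthProfile q 1 (t.leafData.map Prod.snd : List ℝ) := by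
  induction h with
  | leaf x => simpa [leafData_leaf] using LengthProfile.zero
  | node i cs hne hlen _ ih =>
    have := LengthProfile.split 0 0 i cs.length LengthProfile.zero
      (List.length_pos_iff.2 hne) hlen
    simpa using lengthProfile_children i cs ih 0 (by simpa using this)

/-- Any leaf of a decoding tree may be replaced by another decoding tree. -/
theorem WF.exists_graft {t : PTree n q} (h : t.WF) {t' : PTree n q} (h' : t'.WF) :
    ∀ (a : ℝ × ℝ) (D : Multiset (ℝ × ℝ)), (t.leafData : Multiset (ℝ × ℝ)) = a ::ₘ D →
      ∃ s : PTree n q, s.WF ∧ (s.leafData : Multiset (ℝ × ℝ)) =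
        (t'.leafData : Multiset (ℝ × ℝ)).map (fun pr => (pr.1, pr.2 + a.2)) + D := by
  induction h with
  | leaf x =>
    intro a D hD
    have hc := congrArg Multiset.card hD
    simp [leafData_leaf] at hc
    subst hc
    simp [leafData_leaf] at hD
    subst hD
    exact ⟨t', h', by simp⟩
  | node i cs hne hlen hcs ih =>
    intro a D hD
    have ha : a ∈ (PTree.node i cs).leafData := by
      rw [← Multiset.mem_coe, hD]
      exact Multiset.mem_cons_self _ _
    rw [leafData_node] at ha
    obtain ⟨b, hb, rfl⟩ := List.mem_map.1 ha
    obtain ⟨d, hd, hbd⟩ := List.mem_flatten.1 hb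
    obtain ⟨c, hc, rfl⟩ := List.mem_map.1 hd
    obtain ⟨E, hE⟩ := Multiset.exists_cons_of_mem (Multiset.mem_coe.2 hbd)
    obtain ⟨s, hs, hsD⟩ := ih c hc b E hE
    obtain ⟨as, bs, rfl⟩ := List.append_of_mem hc
    refine ⟨PTree.node i (as ++ s :: bs), WF.node _ _ (by simp) (by simpa using hlen) ?_, ?_⟩
    · intro e he
      simp only [List.mem_append, List.mem_cons] at he
      rcases he with he | rfl | he
      · exact hcs e (by simp [he])
      · exact hs
      · exact hcs e (by simp [he])
    · rw [leafData_node] at hD ⊢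
      simp only [List.map_append, List.map_cons, List.flatten_append, List.flatten_cons,
        ← Multiset.coe_add, ← Multiset.map_coe, Multiset.map_add, hE, hsD,
        Multiset.map_cons, Multiset.map_map, Function.comp_def, Multiset.add_cons,
        Multiset.cons_add, Multiset.cons_inj_right] at hD ⊢
      rw [← hD]
      simp only [add_assoc, add_left_comm]

theorem exists_wf_of_lengthProfile {L : Multiset ℝ} (h : LengthProfile q 1 L) :
    ∀ D : Multiset (ℝ × ℝ), D.map Prod.snd = L →
      ∃ t : PTree n q, t.WF ∧ (t.leafData : Multiset (ℝ × ℝ)) = D := by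
  induction h with
  | zero =>
    intro D hD
    obtain ⟨a, rfl, ha⟩ := Multiset.map_eq_singleton.1 hD
    exact ⟨leaf a.1, WF.leaf _, by simp [leafData_leaf, ← ha]⟩
  | split l L i k _ h1 h2 ih =>
    intro D hD
    obtain ⟨A, B, rfl, hA, hB⟩ := exists_add_of_map_eq_add hD
    obtain ⟨t, ht, htD⟩ := ih ((0, l) ::ₘ B) (by simp [hB])
    have hcard : A.card = k := by simpa using congrArg Multiset.card hA
    have hnode : (node i (A.toList.map fun a => leaf a.1) : PTree n q).WF := by
      refine WF.node _ _ ?_ (by simpa [hcard] using h2) ?_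
      · rw [← List.length_pos_iff]
        simp [hcard]
        omega
      · intro c hc
        obtain ⟨a, -, rfl⟩ := List.mem_map.1 hc
        exact WF.leaf _
    obtain ⟨s, hs, hsD⟩ := ht.exists_graft hnode _ _ htD
    refine ⟨s, hs, hsD.trans ?_⟩
    congr 1
    have hf : (List.map (leafData ∘ fun a : ℝ × ℝ => (leaf a.1 : PTree n q)) A.toList).flatten =
        A.toList.map fun a => (a.1, 0) := by
      simp only [Function.comp_def, leafData_leaf, ← List.flatMap_def]
      exact List.map_eq_flatMap.symm
    rw [leafData_node, List.map_map, hf, ← Multiset.map_coe, ← Multiset.map_coe,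
      Multiset.coe_toList, Multiset.map_map, Multiset.map_map]
    conv_rhs => rw [← Multiset.map_id A]
    refine Multiset.map_congr rfl fun a ha => ?_
    have : a.2 = l + Real.log (q i) :=
      Multiset.eq_of_mem_replicate (hA ▸ Multiset.mem_map_of_mem _ ha)
    ext <;> simp [this, add_comm]

end PTree

/-- The expected codeword lengths of decoding trees for the masses `P`. -/
def treeLengths {n : ℕ} (q : Fin n → ℕ) (P : Multiset ℝ) : Set ℝ :=
  {x : ℝ | ∃ t : PTree n q, t.WF ∧
    (∃ w : ℕ, (t.leafMasses : Multiset ℝ) = P + Multiset.replicate w 0) ∧ x = t.expLen}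

section

variable {n : ℕ} {q : Fin n → ℕ}

theorem mem_treeLengths_iff {P : Multiset ℝ} {x : ℝ} :
    x ∈ treeLengths q P ↔ ∃ D : Multiset (ℝ × ℝ), LengthProfile q 1 (D.map Prod.snd) ∧
      (∃ w : ℕ, D.map Prod.fst = P + Multiset.replicate w 0) ∧
      x = (D.map fun pr => pr.1 * pr.2).sum := by
  constructor
  · rintro ⟨t, ht, ⟨w, hw⟩, rfl⟩
    refine ⟨t.leafData, ht.lengthProfile, ⟨w, ?_⟩, ?_⟩
    · rw [← hw, ht.leafMasses_eq, Multiset.map_coe]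
    · rw [Multiset.map_coe, Multiset.sum_coe, PTree.expLen]
  · rintro ⟨D, hD, ⟨w, hw⟩, rfl⟩
    obtain ⟨t, ht, rfl⟩ := PTree.exists_wf_of_lengthProfile hD D rfl
    refine ⟨t, ht, ⟨w, ?_⟩, ?_⟩
    · rw [← hw, ht.leafMasses_eq, Multiset.map_coe]
    · rw [Multiset.map_coe, Multiset.sum_coe, PTree.expLen]

theorem treeLengths_nonneg {P : Multiset ℝ} (hP : ∀ a ∈ P, 0 ≤ a) {x : ℝ}
    (hx : x ∈ treeLengths q P) : 0 ≤ x := by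
  obtain ⟨D, hD, ⟨w, hw⟩, rfl⟩ := mem_treeLengths_iff.1 hx
  refine Multiset.sum_nonneg fun y hy => ?_
  obtain ⟨d, hd, rfl⟩ := Multiset.mem_map.1 hy
  have h1 : d.1 ∈ D.map Prod.fst := Multiset.mem_map_of_mem _ hd
  refine mul_nonneg ?_ (hD.nonneg _ (Multiset.mem_map_of_mem _ hd))
  rw [hw] at h1
  rcases Multiset.mem_add.1 h1 with h1 | h1
  · exact hP _ h1
  · exact (Multiset.eq_of_mem_replicate h1).ge

/-- Splitting a leaf of mass `S.sum` into leaves with masses `S` by a node of class `i`. -/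
theorem add_mem_treeLengths {S Q : Multiset ℝ} {i : Fin n} (h0 : S ≠ 0) (hS : S.card ≤ q i)
    {y : ℝ} (hy : y ∈ treeLengths q (S.sum ::ₘ Q)) :
    y + S.sum * Real.log (q i) ∈ treeLengths q (S + Q) := by
  obtain ⟨D, hD, ⟨w, hw⟩, rfl⟩ := mem_treeLengths_iff.1 hy
  have hmem : S.sum ∈ D.map Prod.fst := by simp [hw]
  obtain ⟨d, hd, hdS⟩ := Multiset.mem_map.1 hmem
  obtain ⟨E, rfl⟩ := Multiset.exists_cons_of_mem hd
  rw [Multiset.map_cons, hdS, Multiset.cons_add, Multiset.cons_inj_right] at hw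
  rw [Multiset.map_cons] at hD
  refine mem_treeLengths_iff.2 ⟨S.map (fun a => (a, d.2 + Real.log (q i))) + E, ?_, ⟨w, ?_⟩, ?_⟩
  · have := hD.split _ _ i S.card (Multiset.card_pos.2 h0) hS
    simpa [Multiset.map_map, Function.comp_def, Multiset.map_const'] using this
  · simp [Multiset.map_map, hw, add_assoc]
  · simp [Multiset.map_map, Multiset.sum_map_mul_right, hdS]
    ring

/-- Exchange argument: the smallest masses may be moved to the longest codewords. -/
theorem exists_exchange (μ : ℝ) (L : Multiset ℝ) (hL : ∀ x ∈ L, x ≤ μ) (k : ℕ) :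
    ∀ (ps : List ℝ) (D : Multiset (ℝ × ℝ)), ps.Pairwise (· ≤ ·) → D.map Prod.fst = ps →
      D.map Prod.snd = Multiset.replicate k μ + L →
      ∃ E : Multiset (ℝ × ℝ), E.map Prod.fst = (ps.drop k : List ℝ) ∧ E.map Prod.snd = L ∧
        (E.map fun pr => pr.1 * pr.2).sum + (ps.take k).sum * μ ≤
          (D.map fun pr => pr.1 * pr.2).sum := by
  induction k with
  | zero =>
    intro ps D _ h1 h2
    exact ⟨D, by simpa using h1, by simpa using h2, by simp⟩
  | succ k ih =>
    intro ps D hps h1 h2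
    cases ps with
    | nil =>
      have : D = 0 := by simpa using h1
      subst this
      have := congrArg Multiset.card h2
      simp at this
    | cons a ps =>
      rw [Multiset.replicate_succ, Multiset.cons_add] at h2
      have hmem : a ∈ D.map Prod.fst := by simp [h1]
      obtain ⟨⟨a, s⟩, hd, rfl⟩ := Multiset.mem_map.1 hmem
      obtain ⟨D, rfl⟩ := Multiset.exists_cons_of_mem hd
      have hps' := List.pairwise_cons.1 hps
      simp only [Multiset.map_cons, ← Multiset.cons_coe, Multiset.cons_inj_right] at h1 h2
      by_cases hs : s = μ
      · subst hs
        rw [Multiset.cons_inj_right] at h2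
        obtain ⟨E, hE1, hE2, hE3⟩ := ih ps D hps'.2 h1 h2
        refine ⟨E, by simpa using hE1, hE2, ?_⟩
        simp only [List.take_succ_cons, List.sum_cons, Multiset.map_cons, Multiset.sum_cons]
        linarith
      · have hmem : μ ∈ D.map Prod.snd := by
          have : μ ∈ s ::ₘ D.map Prod.snd := by simp [h2]
          exact (Multiset.mem_cons.1 this).resolve_left (Ne.symm hs)
        obtain ⟨⟨b, μ⟩, hd, rfl⟩ := Multiset.mem_map.1 hmem
        obtain ⟨D, rfl⟩ := Multiset.exists_cons_of_mem hd
        have hab : a ≤ b := hps'.1 b (by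
          rw [← Multiset.mem_coe, ← h1]
          simp)
        have hsμ : s ≤ μ := by
          have : s ∈ μ ::ₘ (Multiset.replicate k μ + L) := by
            rw [← h2]
            simp
          rcases Multiset.mem_cons.1 this with h | h
          · exact h.le
          · rcases Multiset.mem_add.1 h with h | h
            · exact (Multiset.eq_of_mem_replicate h).le
            · exact hL _ h
        simp only [Multiset.map_cons] at h1 h2
        rw [Multiset.cons_swap, Multiset.cons_inj_right] at h2
        obtain ⟨E, hE1, hE2, hE3⟩ := ih ps ((b, s) ::ₘ D) hps'.2 (by simpa using h1)
          (by simpa using h2)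
        refine ⟨E, by simpa using hE1, hE2, ?_⟩
        simp only [List.take_succ_cons, List.sum_cons, Multiset.map_cons, Multiset.sum_cons]
          at hE3 ⊢
        nlinarith [mul_nonneg (sub_nonneg.2 hab) (sub_nonneg.2 hsμ)]

theorem exists_shorter_assignment {L : Multiset ℝ} {D : Multiset (ℝ × ℝ)}
    (h : Multiset.Rel (fun a d => a ≤ d.2) L D) (h0 : ∀ d ∈ D, 0 ≤ d.1) :
    ∃ E : Multiset (ℝ × ℝ), E.map Prod.fst = D.map Prod.fst ∧ E.map Prod.snd = L ∧
      (E.map fun pr => pr.1 * pr.2).sum ≤ (D.map fun pr => pr.1 * pr.2).sum := by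
  induction h with
  | zero => exact ⟨0, by simp⟩
  | @cons a d L D had _ ih =>
    obtain ⟨E, h1, h2, h3⟩ := ih fun d hd => h0 d (Multiset.mem_cons_of_mem hd)
    refine ⟨(d.1, a) ::ₘ E, by simp [h1], by simp [h2], ?_⟩
    simp only [Multiset.map_cons, Multiset.sum_cons]
    exact add_le_add (mul_le_mul_of_nonneg_left had (h0 d (Multiset.mem_cons_self _ _))) h3

/-- Every decoding tree for sorted masses is at least as long as one in which some number `k` of
smallest masses are siblings. -/
theorem exists_merge_le (hq : ∀ i, 2 ≤ q i) {ps : List ℝ} (hps : ps.Pairwise (· ≤ ·))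
    (h0 : ∀ a ∈ ps, 0 ≤ a) (hlen : 2 ≤ ps.length) {x : ℝ} (hx : x ∈ treeLengths q ps) :
    ∃ (k : ℕ) (i : Fin n), 2 ≤ k ∧ k ≤ q i ∧ k ≤ ps.length ∧
      ∃ y ∈ treeLengths q ((ps.take k).sum ::ₘ (ps.drop k : List ℝ)),
        y + (ps.take k).sum * Real.log (q i) ≤ x := by
  obtain ⟨D, hD, ⟨w, hw⟩, rfl⟩ := mem_treeLengths_iff.1 hx
  obtain ⟨A, B, rfl, hA, hB⟩ := exists_add_of_map_eq_add hw
  have hBsum : 0 = (B.map fun pr => pr.1 * pr.2).sum := by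
    refine (Multiset.sum_eq_zero fun y hy => ?_).symm
    obtain ⟨d, hd, rfl⟩ := Multiset.mem_map.1 hy
    have : d.1 = 0 := Multiset.eq_of_mem_replicate (hB ▸ Multiset.mem_map_of_mem _ hd)
    simp [this]
  have hcard : A.card = ps.length := by simpa using congrArg Multiset.card hA
  rw [Multiset.map_add] at hD
  obtain ⟨L, hL, hrel⟩ := hD.exists_rel_le (A.map Prod.snd) (Multiset.le_add_right _ _) (by
    rw [Ne, ← Multiset.card_eq_zero]
    simp only [Multiset.card_map]
    omega)
  rw [Multiset.rel_map_right] at hrel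
  obtain ⟨E, hE1, rfl, hE3⟩ := exists_shorter_assignment hrel fun d hd =>
    h0 _ (Multiset.mem_coe.1 (hA ▸ Multiset.mem_map_of_mem _ hd))
  have hcardE : E.card = ps.length := by simpa using congrArg Multiset.card (hE1.trans hA)
  rcases hL.exists_max_split hq with h | ⟨l, L, i, k, hL', hk, hki, heq, hmax⟩
  · have := congrArg Multiset.card h
    simp at this
    omega
  · have hkl : k ≤ ps.length := by
      have := congrArg Multiset.card heq
      simp at this
      omega
    obtain ⟨F, hF1, hF2, hF3⟩ := exists_exchange _ L hmax k ps E hps (hE1.trans hA) heq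
    refine ⟨k, i, hk, hki, hkl, (((((ps.take k).sum, l) ::ₘ F).map fun pr => pr.1 * pr.2)).sum,
      mem_treeLengths_iff.2 ⟨_, ?_, ⟨0, ?_⟩, rfl⟩, ?_⟩
    · simpa [hF2] using hL'.anti one_le_two
    · simp [hF1]
    · simp only [Multiset.map_cons, Multiset.sum_cons, Multiset.map_add, Multiset.sum_add]
      linarith

variable (q) in
/-- The smallest alphabet size that is at least `k`. -/
noncomputable def minAlphabet (k : ℕ) : ℕ := sInf {v : ℕ | (∃ i : Fin n, q i = v) ∧ k ≤ v}

theorem minAlphabet_le {k : ℕ} {i : Fin n} (h : k ≤ q i) : minAlphabet q k ≤ q i :=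
  Nat.sInf_le ⟨⟨i, rfl⟩, h⟩

theorem exists_eq_minAlphabet {k : ℕ} {i : Fin n} (h : k ≤ q i) :
    ∃ j, q j = minAlphabet q k ∧ k ≤ q j := by
  obtain ⟨⟨j, hj⟩, hk⟩ := Nat.sInf_mem (s := {v : ℕ | (∃ i : Fin n, q i = v) ∧ k ≤ v})
    ⟨q i, ⟨i, rfl⟩, h⟩
  exact ⟨j, hj, hj ▸ hk⟩

variable (q) in
/-- The values of the merge recurrence for the sorted list of masses `ps`, where `b` bounds the
number of merged masses. -/
def mergeValues (b : ℕ) (ps : List ℝ) : Set ℝ :=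
  {x : ℝ | ∃ k : ℕ, 2 ≤ k ∧ k ≤ min b ps.length ∧
    x = sInf (treeLengths q ((ps.take k).sum ::ₘ (ps.drop k : List ℝ))) +
      (ps.take k).sum * Real.log (minAlphabet q k)}

/-- If the merged sources have optimal trees, then the minimum of the merge recurrence is the
minimum expected codeword length. -/
theorem isLeast_treeLengths_of_merge (hq : ∀ i, 2 ≤ q i) (i₀ : Fin n) (hi₀ : ∀ i, q i ≤ q i₀)
    {ps : List ℝ} (hps : ps.Pairwise (· ≤ ·)) (h0 : ∀ a ∈ ps, 0 ≤ a) (hlen : 2 ≤ ps.length)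
    (hopt : ∀ k, 2 ≤ k → k ≤ ps.length →
      ∃ y, IsLeast (treeLengths q ((ps.take k).sum ::ₘ (ps.drop k : List ℝ))) y) :
    IsLeast (treeLengths q ps) (sInf (mergeValues q (q i₀) ps)) := by
  have hfin : (mergeValues q (q i₀) ps).Finite := by
    refine ((Set.finite_Iic (min (q i₀) ps.length)).image fun k =>
      sInf (treeLengths q ((ps.take k).sum ::ₘ (ps.drop k : List ℝ))) +
        (ps.take k).sum * Real.log (minAlphabet q k)).subset ?_
    rintro x ⟨k, -, hk, rfl⟩
    exact ⟨k, hk, rfl⟩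
  have hne : (mergeValues q (q i₀) ps).Nonempty := ⟨_, 2, le_rfl, le_min (hq _) hlen, rfl⟩
  constructor
  · obtain ⟨k, hk2, hk, heq⟩ := hne.csInf_mem hfin
    rw [heq]
    obtain ⟨y, hy⟩ := hopt k hk2 (hk.trans (min_le_right _ _))
    obtain ⟨j, hj, hkj⟩ := exists_eq_minAlphabet (hk.trans (min_le_left _ _))
    have hlk : (ps.take k).length = k := by
      simpa using hk.trans (min_le_right _ _)
    have := add_mem_treeLengths (q := q) (S := (ps.take k : List ℝ)) (Q := (ps.drop k : List ℝ))
      (i := j) (y := y) (by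
        rw [Ne, ← Multiset.card_eq_zero, Multiset.coe_card]
        omega) (by
        rw [Multiset.coe_card]
        omega) (by simpa using hy.1)
    rw [hy.csInf_eq, ← hj]
    rwa [Multiset.coe_add, List.take_append_drop, Multiset.sum_coe] at this
  · intro x hx
    obtain ⟨k, i, hk2, hki, hkl, y, hy, hyx⟩ := exists_merge_le hq hps h0 hlen hx
    obtain ⟨z, hz⟩ := hopt k hk2 hkl
    have hS : 0 ≤ (ps.take k).sum := List.sum_nonneg fun a ha => h0 a (List.mem_of_mem_take ha)
    refine (csInf_le hfin.bddBelow ⟨k, hk2, le_min (hki.trans (hi₀ i)) hkl, rfl⟩).trans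
      (le_trans ?_ hyx)
    rw [hz.csInf_eq]
    obtain ⟨j, hj, hkj⟩ := exists_eq_minAlphabet hki
    refine add_le_add (hz.2 hy) (mul_le_mul_of_nonneg_left (Real.log_le_log ?_ ?_) hS)
    · rw [← hj]
      exact_mod_cast (show 0 < q j by linarith [hq j])
    · exact_mod_cast minAlphabet_le hki

theorem exists_isLeast_treeLengths (hq : ∀ i, 2 ≤ q i) (i₀ : Fin n) (hi₀ : ∀ i, q i ≤ q i₀)
    (m : ℕ) : ∀ P : Multiset ℝ, P.card = m → P ≠ 0 → (∀ a ∈ P, 0 ≤ a) →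
      ∃ y, IsLeast (treeLengths q P) y := by
  induction m using Nat.strong_induction_on with
  | _ m ih =>
    intro P hm hne h0
    rcases (show m = 1 ∨ 2 ≤ m by
      have := Multiset.card_pos.2 hne
      omega) with rfl | h2
    · obtain ⟨a, rfl⟩ := Multiset.card_eq_one.1 hm
      refine ⟨0, mem_treeLengths_iff.2 ⟨{(a, 0)}, ?_, ⟨0, by simp⟩, by simp⟩,
        fun x hx => treeLengths_nonneg h0 hx⟩
      simpa using LengthProfile.zero
    · have hsort : ((P.sort (· ≤ ·) : List ℝ) : Multiset ℝ) = P := Multiset.sort_eq _ _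
      have hl : (P.sort (· ≤ ·)).length = m := by simp [hm]
      have h0' : ∀ a ∈ P.sort (· ≤ ·), 0 ≤ a := fun a ha => h0 a (by simpa using ha)
      refine ⟨_, hsort ▸ isLeast_treeLengths_of_merge hq i₀ hi₀ (Multiset.pairwise_sort P _) h0'
        (by omega) fun k hk2 hk => ih (m - k + 1) (by omega) _ (by simp [hm])
          (Multiset.cons_ne_zero) fun a ha => ?_⟩
      rcases Multiset.mem_cons.1 ha with rfl | ha
      · exact List.sum_nonneg fun a ha => h0' a (List.mem_of_mem_take ha)
      · exact h0' a (List.mem_of_mem_drop (Multiset.mem_coe.1 ha))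

end

/-- **Optimality of the multi-channel Huffman merge recurrence**: for sorted source masses
`p 1 ≤ … ≤ p m` (`m ≥ 2`, summing to `1`), the minimum expected codeword length satisfies
`L_opt(p 1, …, p m) = min_{k ∈ {2,…,min(q n, m)}}
  [ L_opt((p 1 + ⋯ + p k), p (k+1), …, p m) + (∑_{j ≤ k} p j) · ln (q i*(k)) ]`,
where `q i*(k)` is the smallest alphabet size with `q i*(k) ≥ k`.  Consequently, some merge
sequence of the generalized Huffman procedure produces an optimal multi-channel
tree-decodable code: an optimal decoding tree attaining `L_opt` exists. -/
theorem huffman_merge_recurrence (n : ℕ) (hn : 0 < n)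
    (q : Fin n → ℕ) (hq : ∀ i, 2 ≤ q i) (hmono : Monotone q)
    (m : ℕ) (hm : 2 ≤ m) (p : Fin m → ℝ) (hmp : Monotone p) (hp : ∀ j, 0 < p j)
    (hsum : ∑ j, p j = 1) :
    (Lopt n q ((List.ofFn p : List ℝ) : Multiset ℝ) =
      sInf {x : ℝ | ∃ k : ℕ, 2 ≤ k ∧ k ≤ min (q ⟨n - 1, Nat.sub_lt hn Nat.one_pos⟩) m ∧
        x = Lopt n q ((((List.ofFn p).take k).sum) ::ₘ
              (((List.ofFn p).drop k : List ℝ) : Multiset ℝ))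
            + (((List.ofFn p).take k).sum) *
              Real.log (sInf {v : ℕ | (∃ i : Fin n, q i = v) ∧ k ≤ v} : ℕ)}) ∧
    ∃ t : PTree n q, t.WF ∧
      (∃ w : ℕ, (t.leafMasses : Multiset ℝ) =
        ((List.ofFn p : List ℝ) : Multiset ℝ) + Multiset.replicate w 0) ∧
      t.expLen = Lopt n q ((List.ofFn p : List ℝ) : Multiset ℝ) := by
  have hi₀ : ∀ i, q i ≤ q ⟨n - 1, Nat.sub_lt hn Nat.one_pos⟩ := fun i =>
    hmono (Fin.le_def.2 (Nat.le_sub_one_of_lt i.2))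
  have h0 : ∀ a ∈ List.ofFn p, 0 ≤ a := by
    intro a ha
    obtain ⟨j, rfl⟩ := (List.mem_ofFn' _ _).1 ha
    exact (hp j).le
  have hmain := isLeast_treeLengths_of_merge hq _ hi₀ (ps := List.ofFn p)
    hmp.sortedLE_ofFn.pairwise h0 (by simpa using hm) fun k _ _ =>
      exists_isLeast_treeLengths hq _ hi₀ _ _ rfl (Multiset.cons_ne_zero) fun a ha => by
        rcases Multiset.mem_cons.1 ha with rfl | ha
        · exact List.sum_nonneg fun a ha => h0 a (List.mem_of_mem_take ha)
        · exact h0 a (List.mem_of_mem_drop (Multiset.mem_coe.1 ha))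
  have hL : Lopt n q (List.ofFn p : List ℝ) = _ := hmain.csInf_eq
  refine ⟨?_, ?_⟩
  · rw [hL, mergeValues, List.length_ofFn]
    rfl
  · obtain ⟨t, ht, hw, hx⟩ := hmain.1
    exact ⟨t, ht, hw, hx.symm.trans hL.symm⟩
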